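/- Let F : F_{2^n} → F_{2^n} be a function such that S_F = {(x, F(x)) : x ∈ F_{2^n}} is formally self dual under the trace pairing ⟨(x,y),(a,b)⟩ = (−1)^{Tr(ax+by)}. Then F is a bijection and the set S_{F⁻¹} = {(x, F⁻¹(x)) : x ∈ F_{2^n}}, where F⁻¹ is the compositional inverse of F, is also formally self dual under the trace pairing. -/

import Mathlib

open scoped Classical

/-- The sign `(−1)^{Tr(t)} ∈ ℤ`, with `Tr` the absolute trace of `F_{2^n}`. -/
noncomputable def sgn {n : ℕ} (t : GaloisField 2 n) : ℤ :=
  (-1) ^ (Algebra.trace (ZMod 2) (GaloisField 2 n) t).val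

/-- The weight enumerator `ν_S(a,b) = #{(u,v) ∈ S×S : u − v = (a,b)}`. -/
noncomputable def nu2 {n : ℕ} (S : Set (GaloisField 2 n × GaloisField 2 n))
    (g : GaloisField 2 n × GaloisField 2 n) : ℕ :=
  Nat.card {q : (GaloisField 2 n × GaloisField 2 n) × (GaloisField 2 n × GaloisField 2 n) //
    q.1 ∈ S ∧ q.2 ∈ S ∧ q.1 - q.2 = g}

/-- `S ⊆ F_{2^n} × F_{2^n}` is formally self dual under the trace pairing
`⟨(x,y),(a,b)⟩ = (−1)^{Tr(ax+by)}`. -/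
noncomputable def FSDTrace {n : ℕ} (S : Set (GaloisField 2 n × GaloisField 2 n)) : Prop :=
  ∀ a b : GaloisField 2 n,
    (∑ᶠ s ∈ S, sgn (a * s.1 + b * s.2)) ^ 2 = (Nat.card S : ℤ) * nu2 S (a, b)

/-- The graph `S_F = {(x, F(x)) : x ∈ F_{2^n}}`. -/
def graphSet {n : ℕ} (F : GaloisField 2 n → GaloisField 2 n) :
    Set (GaloisField 2 n × GaloisField 2 n) :=
  {q | ∃ x : GaloisField 2 n, q = (x, F x)}

/-- `δ_F(a,b) = #{x : F(x+a) + F(x) = b}`. -/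
noncomputable def deltaF {n : ℕ} (F : GaloisField 2 n → GaloisField 2 n)
    (a b : GaloisField 2 n) : ℕ :=
  Nat.card {x : GaloisField 2 n // F (x + a) + F x = b}

/-- The Walsh transform `W_F(a,b) = ∑_x (−1)^{Tr(bF(x)+ax)}`. -/
noncomputable def walsh {n : ℕ} (F : GaloisField 2 n → GaloisField 2 n)
    (a b : GaloisField 2 n) : ℤ :=
  ∑ᶠ x : GaloisField 2 n, sgn (b * F x + a * x)

theorem sgn_add {n : ℕ} (s t : GaloisField 2 n) : sgn (s + t) = sgn s * sgn t := by
  unfold sgn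
  rw [map_add]
  generalize Algebra.trace (ZMod 2) (GaloisField 2 n) s = u
  generalize Algebra.trace (ZMod 2) (GaloisField 2 n) t = v
  revert u v
  decide

theorem sgn_zero {n : ℕ} : sgn (0 : GaloisField 2 n) = 1 := by
  simp [sgn]

theorem exists_sgn_eq_neg_one (n : ℕ) : ∃ u : GaloisField 2 n, sgn u = -1 := by
  obtain ⟨u, hu⟩ := Algebra.trace_surjective (ZMod 2) (GaloisField 2 n) 1
  exact ⟨u, by simp [sgn, hu, ZMod.val_one]⟩

theorem sum_sgn_mul_eq_zero {n : ℕ} [Fintype (GaloisField 2 n)] {t : GaloisField 2 n}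
    (ht : t ≠ 0) : ∑ b : GaloisField 2 n, sgn (b * t) = 0 := by
  obtain ⟨u, hu⟩ := exists_sgn_eq_neg_one n
  have hsum : ∑ b : GaloisField 2 n, sgn (b * t) = ∑ b : GaloisField 2 n, sgn b :=
    Equiv.sum_comp (Equiv.mulRight₀ t ht) sgn
  have hshift : ∑ b : GaloisField 2 n, sgn (b + u) = ∑ b : GaloisField 2 n, sgn b :=
    Equiv.sum_comp (Equiv.addRight u) sgn
  simp only [sgn_add, hu, mul_neg, mul_one, Finset.sum_neg_distrib] at hshift
  linarith

theorem finsum_mem_graphSet {n : ℕ} [Fintype (GaloisField 2 n)]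
    (F : GaloisField 2 n → GaloisField 2 n) (f : GaloisField 2 n × GaloisField 2 n → ℤ) :
    ∑ᶠ s ∈ graphSet F, f s = ∑ x, f (x, F x) := by
  have hrange : graphSet F = Set.range fun x => (x, F x) := by
    ext q
    simp [graphSet, eq_comm]
  rw [hrange, finsum_mem_range fun x y hxy => congrArg Prod.fst hxy, finsum_eq_sum_of_fintype]

theorem nu2_graphSet_zero_left {n : ℕ} (F : GaloisField 2 n → GaloisField 2 n)
    {b : GaloisField 2 n} (hb : b ≠ 0) : nu2 (graphSet F) (0, b) = 0 := by
  unfold nu2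
  rw [Nat.card_eq_zero]
  refine Or.inl ⟨?_⟩
  rintro ⟨⟨_, _⟩, ⟨x, rfl⟩, ⟨y, rfl⟩, hxy⟩
  obtain ⟨h₁, h₂⟩ := Prod.mk.inj hxy
  obtain rfl : x = y := sub_eq_zero.mp h₁
  exact hb (by simpa using h₂.symm)

theorem FSDTrace.surjective {n : ℕ} {F : GaloisField 2 n → GaloisField 2 n}
    (h : FSDTrace (graphSet F)) : Function.Surjective F := by
  have := Fintype.ofFinite (GaloisField 2 n)
  have hwalsh : ∀ b : GaloisField 2 n, b ≠ 0 → ∑ x, sgn (b * F x) = 0 := by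
    intro b hb
    have hsq := h 0 b
    rw [nu2_graphSet_zero_left F hb, finsum_mem_graphSet] at hsq
    simpa using hsq
  by_contra hsurj
  obtain ⟨c, hc⟩ := not_forall.mp hsurj
  have hzero : ∑ x, ∑ b, sgn (b * (F x + c)) = 0 := by
    refine Finset.sum_eq_zero fun x _ => sum_sgn_mul_eq_zero fun hx => hc ⟨x, ?_⟩
    exact CharTwo.add_eq_zero.mp hx
  rw [Finset.sum_comm, Finset.sum_eq_single 0] at hzero
  · simp [sgn_zero] at hzero
  · intro b _ hb
    simp only [mul_add, sgn_add]
    rw [← Finset.sum_mul, hwalsh b hb, zero_mul]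
  · simp

theorem FSDTrace.preimage_swap {n : ℕ} {S : Set (GaloisField 2 n × GaloisField 2 n)}
    (h : FSDTrace S) : FSDTrace (Prod.swap ⁻¹' S) := by
  intro a b
  have hsum : ∑ᶠ s ∈ Prod.swap ⁻¹' S, sgn (a * s.1 + b * s.2) =
      ∑ᶠ s ∈ S, sgn (b * s.1 + a * s.2) := by
    rw [← finsum_comp_equiv (Equiv.prodComm (GaloisField 2 n) (GaloisField 2 n))]
    simp [add_comm]
  have hcard : Nat.card (Prod.swap ⁻¹' S) = Nat.card S :=
    Nat.card_congr ((Equiv.prodComm _ _).subtypeEquiv fun _ => Iff.rfl)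
  have hnu : nu2 (Prod.swap ⁻¹' S) (a, b) = nu2 S (b, a) := by
    refine Nat.card_congr
      (((Equiv.prodComm _ _).prodCongr (Equiv.prodComm _ _)).subtypeEquiv fun q => ?_)
    simp [Prod.ext_iff, and_comm]
  rw [hsum, hcard, hnu, h b a]

theorem stmt17 (n : ℕ) (hn : 0 < n) (F : GaloisField 2 n → GaloisField 2 n)
    (h : FSDTrace (graphSet F)) :
    Function.Bijective F ∧
      ∀ Finv : GaloisField 2 n → GaloisField 2 n,
        Function.LeftInverse Finv F → Function.RightInverse Finv F →
        FSDTrace (graphSet Finv) := by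
  refine ⟨Finite.injective_iff_bijective.mp
    (Finite.injective_iff_surjective.mpr h.surjective), fun Finv hl hr => ?_⟩
  have hgraph : graphSet Finv = Prod.swap ⁻¹' graphSet F := by
    ext ⟨x, y⟩
    simp only [graphSet, Set.mem_ofPred_eq, Set.mem_preimage, Prod.swap_prod_mk, Prod.mk.injEq,
      exists_eq_left']
    exact ⟨fun hy => hy ▸ (hr x).symm, fun hx => hx ▸ (hl y).symm⟩
  rw [hgraph]
  exact h.preimage_swap
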